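/- Let p be a prime and let G be a finitely generated nilpotent group. If the torsion subgroup τ(G) is a p-group and the quotient group G/τ(G) is abelian, then G is conjugacy F_p-separable. -/

import Mathlib

/-- `G` is conjugacy `F_p`-separable: whenever `a, b ∈ G` are not conjugate in `G`,
there exists a surjective homomorphism `φ` of `G` onto some finite `p`-group `X`
such that `φ a` and `φ b` are not conjugate in `X`. -/
def IsConjFpSeparable (p : ℕ) (G : Type) [Group G] : Prop :=
  ∀ a b : G, ¬ IsConj a b →
    ∃ (X : Type) (_ : Group X) (_ : Fintype X),
      IsPGroup p X ∧
      ∃ φ : G →* X, Function.Surjective φ ∧ ¬ IsConj (φ a) (φ b)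

open scoped commutatorElement IsMulCommutative

/-- A finitely generated nilpotent torsion group is finite. -/
theorem finite_of_fg_nilpotent_torsion (G : Type*) [Group G] [Group.IsNilpotent G]
    (hfg : Group.FG G) (htor : ∀ g : G, IsOfFinOrder g) : Finite G := by
  revert hfg htor
  refine Group.nilpotent_center_quotient_ind
    (P := fun G _ _ => Group.FG G → (∀ g : G, IsOfFinOrder g) → Finite G) G ?_ ?_
  · intros
    infer_instance
  · intro G _ _ ih hfg htor
    have hquot : Finite (G ⧸ Subgroup.center G) := by
      refine ih inferInstance fun x => ?_
      obtain ⟨g, rfl⟩ := QuotientGroup.mk'_surjective _ x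
      exact MonoidHom.isOfFinOrder (QuotientGroup.mk' _) (htor g)
    have hindex : (Subgroup.center G).FiniteIndex := Subgroup.finiteIndex_of_finite_quotient
    have hcenter : Finite (Subgroup.center G) :=
      CommGroup.finite_of_fg_isMulTorsion _
        (fun z => Submonoid.isOfFinOrder_coe.mp (htor z))
    exact Finite.of_subgroup_quotient (Subgroup.center G)

/-- If `⁅h, x⁆` is central, then `⁅h ^ n, x⁆ = ⁅h, x⁆ ^ n`. -/
theorem commutatorElement_pow_left {G : Type*} [Group G] {h x : G}
    (hc : ⁅h, x⁆ ∈ Subgroup.center G) (n : ℕ) : ⁅h ^ n, x⁆ = ⁅h, x⁆ ^ n := by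
  induction n with
  | zero => simp
  | succ n ih =>
    have hcomm := Subgroup.mem_center_iff.mp (Subgroup.pow_mem _ hc n)
    calc ⁅h ^ (n + 1), x⁆ = h * ⁅h ^ n, x⁆ * h⁻¹ * ⁅h, x⁆ := by
          simp only [commutatorElement_def, pow_succ']; group
      _ = ⁅h, x⁆ ^ (n + 1) := by rw [ih, hcomm h, mul_inv_cancel_right, pow_succ]

/-- In a finitely generated nilpotent group whose commutators have `p`-power order, every element
has a `p`-power in the center. -/
theorem exists_pow_mem_center (p : ℕ) (G : Type*) [Group G] [Group.IsNilpotent G]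
    (hfg : Group.FG G) (hcomm : ∀ x y : G, ∃ k : ℕ, ⁅x, y⁆ ^ p ^ k = 1) (g : G) :
    ∃ k : ℕ, g ^ p ^ k ∈ Subgroup.center G := by
  revert g hcomm hfg
  refine Group.nilpotent_center_quotient_ind
    (P := fun G _ _ => Group.FG G → (∀ x y : G, ∃ k : ℕ, ⁅x, y⁆ ^ p ^ k = 1) →
      ∀ g : G, ∃ k : ℕ, g ^ p ^ k ∈ Subgroup.center G) G ?_ ?_
  · intro G _ _ _ _ g
    exact ⟨0, by rw [Subsingleton.elim (g ^ p ^ 0) 1]; exact one_mem _⟩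
  · intro G _ _ ih hfg hcomm g
    obtain ⟨k, hk⟩ := ih inferInstance (by
      intro x y
      obtain ⟨x, rfl⟩ := QuotientGroup.mk'_surjective _ x
      obtain ⟨y, rfl⟩ := QuotientGroup.mk'_surjective _ y
      obtain ⟨k, hk⟩ := hcomm x y
      exact ⟨k, by rw [← map_commutatorElement, ← map_pow, hk, map_one]⟩)
      (QuotientGroup.mk' _ g)
    have hcenter (x : G) : ⁅g ^ p ^ k, x⁆ ∈ Subgroup.center G := by
      rw [← QuotientGroup.eq_one_iff, ← QuotientGroup.mk'_apply, map_commutatorElement,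
        commutatorElement_eq_one_iff_mul_comm, map_pow]
      exact (Subgroup.mem_center_iff.mp hk _).symm
    choose m hm using hcomm (g ^ p ^ k)
    obtain ⟨S, hS⟩ := Group.fg_def.mp hfg
    refine ⟨k + S.sup m, ?_⟩
    rw [← SetLike.mem_coe, ← Set.singleton_subset_iff,
      ← Subgroup.centralizer_eq_top_iff_subset, eq_top_iff, ← hS,
      Subgroup.closure_le]
    intro x hx
    rw [SetLike.mem_coe, Subgroup.mem_centralizer_singleton_iff, eq_comm,
      ← commutatorElement_eq_one_iff_mul_comm, pow_add, pow_mul,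
      commutatorElement_pow_left (hcenter x)]
    exact orderOf_dvd_iff_pow_eq_one.mp
      ((orderOf_dvd_of_pow_eq_one (hm x)).trans (pow_dvd_pow p (Finset.le_sup hx)))

/-- In a finitely generated abelian group whose elements of finite order have `p`-power order, an
element which is a `p ^ k`-th power for every `k` is trivial. -/
theorem eq_one_of_forall_exists_pow_eq {p : ℕ} (hp : p.Prime) {A : Type*} [CommGroup A]
    [Group.FG A] (htor : ∀ x : A, IsOfFinOrder x → ∃ k : ℕ, x ^ p ^ k = 1) {x : A}
    (hx : ∀ k : ℕ, ∃ y : A, y ^ p ^ k = x) : x = 1 := by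
  have hfin : Module.Finite ℤ (Additive A) := Module.Finite.iff_addGroup_fg.mpr inferInstance
  have hmem : Additive.ofMul x ∈
      (⨅ i : ℕ, Ideal.span {(p : ℤ)} ^ i • ⊤ : Submodule ℤ (Additive A)) := by
    refine (Submodule.mem_iInf _).mpr fun k => ?_
    obtain ⟨y, rfl⟩ := hx k
    have := Submodule.smul_mem_smul
      (Ideal.pow_mem_pow (Ideal.mem_span_singleton_self (p : ℤ)) k)
      (Submodule.mem_top : Additive.ofMul y ∈ (⊤ : Submodule ℤ (Additive A)))
    rwa [← Nat.cast_pow, Nat.cast_smul_eq_nsmul, ← ofMul_pow] at this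
  obtain ⟨⟨r, hr⟩, hrx⟩ := (Ideal.mem_iInf_smul_pow_eq_bot_iff _ _).mp hmem
  obtain ⟨t, rfl⟩ := Ideal.mem_span_singleton.mp hr
  have hpow : x ^ ((p : ℤ) * t - 1) = 1 := by
    rw [zpow_sub_one, mul_inv_eq_one]
    exact congrArg Additive.toMul hrx
  have hne : (p : ℤ) * t - 1 ≠ 0 := fun h =>
    (Nat.prime_iff_prime_int.mp hp).not_dvd_one ⟨t, (sub_eq_zero.mp h).symm⟩
  obtain ⟨k, hk⟩ := htor x (isOfFinOrder_iff_zpow_eq_one.mpr ⟨_, hne, hpow⟩)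
  have hcop : IsCoprime ((p : ℤ) ^ k) ((p : ℤ) * t - 1) :=
    IsCoprime.pow_left ⟨t, -1, by ring⟩
  have hdvd : (orderOf x : ℤ) ∣ (p : ℤ) ^ k := by
    exact_mod_cast orderOf_dvd_of_pow_eq_one hk
  have hunit := hcop.isUnit_of_dvd' hdvd (orderOf_dvd_iff_zpow_eq_one.mpr hpow)
  exact orderOf_eq_one_iff.mp (Int.ofNat_isUnit.mp hunit |> Nat.isUnit_iff.mp)

/-- The subgroup of `n`-th powers of central elements. -/
def centerPow (G : Type*) [Group G] (n : ℕ) : Subgroup G where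
  carrier := {g | ∃ z : Subgroup.center G, (z : G) ^ n = g}
  one_mem' := ⟨1, one_pow n⟩
  mul_mem' := by
    rintro _ _ ⟨y, rfl⟩ ⟨z, rfl⟩
    exact ⟨y * z, congrArg Subtype.val (mul_pow y z n)⟩
  inv_mem' := by
    rintro _ ⟨z, rfl⟩
    exact ⟨z⁻¹, inv_pow _ n⟩

theorem mem_centerPow {G : Type*} [Group G] {n : ℕ} {g : G} :
    g ∈ centerPow G n ↔ ∃ z : Subgroup.center G, (z : G) ^ n = g :=
  Iff.rfl

instance centerPow_normal (G : Type*) [Group G] (n : ℕ) : (centerPow G n).Normal where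
  conj_mem := by
    rintro _ ⟨z, rfl⟩ g
    refine ⟨z, ?_⟩
    rw [Subgroup.mem_center_iff.mp (Subgroup.pow_mem _ z.2 n) g, mul_inv_cancel_right]

/-- Let `p` be a prime and `G` a finitely generated nilpotent group, with torsion
subgroup `τ`. If `τ` is a `p`-group and `G ⧸ τ` is abelian, then `G` is conjugacy
`F_p`-separable. -/
theorem conjFpSeparable_of_torsion_isPGroup_of_quotient_comm
    (p : ℕ) (hp : p.Prime) (G : Type) [Group G] [Group.FG G] [Group.IsNilpotent G]
    (τ : Subgroup G) [τ.Normal] (hτ : ∀ g : G, g ∈ τ ↔ IsOfFinOrder g)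
    (h1 : IsPGroup p τ) (h2 : ∀ x y : G ⧸ τ, x * y = y * x) :
    IsConjFpSeparable p G := by
  have hτp (g : G) (hg : g ∈ τ) : ∃ k : ℕ, g ^ p ^ k = 1 := by
    obtain ⟨k, hk⟩ := h1 ⟨g, hg⟩
    exact ⟨k, congrArg Subtype.val hk⟩
  have hcenter := exists_pow_mem_center p G inferInstance fun x y => hτp _ <| by
    rw [← QuotientGroup.eq_one_iff, ← QuotientGroup.mk'_apply, map_commutatorElement,
      commutatorElement_eq_one_iff_mul_comm]
    exact h2 _ _
  have hfinite_of_isPGroup (N : Subgroup G) [N.Normal] (hN : IsPGroup p (G ⧸ N)) :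
      Finite (G ⧸ N) := by
    refine finite_of_fg_nilpotent_torsion _ inferInstance fun x => ?_
    obtain ⟨k, hk⟩ := hN x
    exact isOfFinOrder_iff_pow_eq_one.mpr ⟨_, pow_pos hp.pos k, hk⟩
  have hquot : Finite (G ⧸ Subgroup.center G) := by
    refine hfinite_of_isPGroup _ fun x => ?_
    obtain ⟨g, rfl⟩ := QuotientGroup.mk_surjective x
    obtain ⟨k, hk⟩ := hcenter g
    exact ⟨k, (QuotientGroup.eq_one_iff _).mpr hk⟩
  have hindex : (Subgroup.center G).FiniteIndex := Subgroup.finiteIndex_of_finite_quotient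
  have hpgroup (k : ℕ) : IsPGroup p (G ⧸ centerPow G (p ^ k)) := fun x => by
    obtain ⟨g, rfl⟩ := QuotientGroup.mk_surjective x
    obtain ⟨j, hj⟩ := hcenter g
    refine ⟨j + k, (QuotientGroup.eq_one_iff _).mpr (mem_centerPow.mpr ⟨⟨_, hj⟩, ?_⟩)⟩
    simp only [pow_add, pow_mul]
  intro a b hab
  by_contra hcon
  have hconj (k : ℕ) : ∃ g : G, g * a * g⁻¹ * b⁻¹ ∈ centerPow G (p ^ k) := by
    have := hfinite_of_isPGroup _ (hpgroup k)
    have hk : IsConj (QuotientGroup.mk' (centerPow G (p ^ k)) a)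
        (QuotientGroup.mk' (centerPow G (p ^ k)) b) := by
      by_contra hk
      exact hcon ⟨_, inferInstance, Fintype.ofFinite _, hpgroup k, _,
        QuotientGroup.mk'_surjective _, hk⟩
    obtain ⟨c, hc⟩ := isConj_iff.mp hk
    obtain ⟨g, rfl⟩ := QuotientGroup.mk'_surjective _ c
    refine ⟨g, (QuotientGroup.eq_one_iff _).mp ?_⟩
    rw [← QuotientGroup.mk'_apply, map_mul, map_inv, mul_inv_eq_one, ← hc]
    simp only [map_mul, map_inv]
  choose g hg using hconj
  -- Conjugation by `g k` depends only on its class modulo the center, so one conjugator works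
  -- for infinitely many `k`.
  obtain ⟨q, hq⟩ := Finite.exists_infinite_fiber fun k => (g k : G ⧸ Subgroup.center G)
  obtain ⟨c, rfl⟩ := QuotientGroup.mk_surjective q
  refine hab (isConj_iff.mpr ⟨c, mul_inv_eq_one.mp ?_⟩)
  have hpowers (k : ℕ) : c * a * c⁻¹ * b⁻¹ ∈ centerPow G (p ^ k) := by
    obtain ⟨n, hn, hkn⟩ := (Set.infinite_coe_iff.mp hq).exists_gt k
    have hz := Subgroup.mem_center_iff.mp (QuotientGroup.eq.mp (Set.mem_singleton_iff.mp hn))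
    have hcg : g n * a * (g n)⁻¹ = c * a * c⁻¹ := by
      have h := hz a
      rw [mul_inv_eq_iff_eq_mul]
      calc g n * a = g n * (a * ((g n)⁻¹ * c)) * c⁻¹ * g n := by group
        _ = c * a * c⁻¹ * g n := by rw [h]; group
    obtain ⟨z, hz⟩ := mem_centerPow.mp (hg n)
    rw [← hcg, ← hz]
    refine mem_centerPow.mpr ⟨z ^ p ^ (n - k), ?_⟩
    rw [Subgroup.coe_pow, ← pow_mul, ← pow_add, Nat.sub_add_cancel hkn.le]
  obtain ⟨z, hz⟩ := mem_centerPow.mp (hpowers 0)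
  rw [pow_zero, pow_one] at hz
  rw [← hz]
  refine congrArg Subtype.val (eq_one_of_forall_exists_pow_eq hp (x := z) ?_ fun k => ?_)
  · intro y hy
    obtain ⟨k, hk⟩ := hτp y ((hτ _).mpr (Submonoid.isOfFinOrder_coe.mpr hy))
    exact ⟨k, Subtype.ext hk⟩
  · obtain ⟨y, hy⟩ := mem_centerPow.mp (hpowers k)
    exact ⟨y, Subtype.ext (hy.trans hz.symm)⟩
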